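/- arXiv:2210.11436 — 3 statements merged into one kernel-verified Lean document; each statement's English description precedes it below -/
import Mathlib

section
/- For each γ > 0 and every x ∈ (0, γ], the inequality log x ≤ (x − 1) − h(γ)(x − 1)² holds, where h(γ) > 0. -/
/-- `h(t) = ((t - 1) - log t)/(t - 1)²` for `t ≠ 1`, and `h(1) = 1/2`. -/
noncomputable def hfun (t : ℝ) : ℝ :=
  if t = 1 then 1 / 2 else ((t - 1) - Real.log t) / (t - 1) ^ 2

theorem one_add_mul_sub_one_pos {t s : ℝ} (ht : 0 < t) (hs : s ∈ Set.Icc (0 : ℝ) 1) :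
    0 < 1 + s * (t - 1) := by
  obtain ⟨h0, h1⟩ := hs
  rcases h1.eq_or_lt with rfl | h1
  · linarith
  · nlinarith [mul_nonneg h0 ht.le]

theorem intervalIntegrable_hfun_kernel {t : ℝ} (ht : 0 < t) :
    IntervalIntegrable (fun s : ℝ => (1 - s) / (1 + s * (t - 1)) ^ 2)
      MeasureTheory.volume 0 1 := by
  apply ContinuousOn.intervalIntegrable
  rw [Set.uIcc_of_le zero_le_one]
  exact ContinuousOn.div (by fun_prop) (by fun_prop)
    fun s hs => pow_ne_zero 2 (one_add_mul_sub_one_pos ht hs).ne'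

/-- The integral form of the second-order Taylor remainder of `log` at `1`. -/
theorem hfun_eq_integral {t : ℝ} (ht : 0 < t) :
    hfun t = ∫ s in (0 : ℝ)..1, (1 - s) / (1 + s * (t - 1)) ^ 2 := by
  by_cases h1 : t = 1
  · subst h1
    have hsub : ∫ s in (0 : ℝ)..1, (1 - s) = 1 / 2 := by
      rw [intervalIntegral.integral_sub (by simp) (by simp)]
      norm_num
    simp [hfun, hsub]
  · have hu : t - 1 ≠ 0 := sub_ne_zero.mpr h1
    have hderiv : ∀ s ∈ Set.uIcc (0 : ℝ) 1,
        HasDerivAt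
          (fun s : ℝ => (-(t / (1 + s * (t - 1))) - Real.log (1 + s * (t - 1))) / (t - 1) ^ 2)
          ((1 - s) / (1 + s * (t - 1)) ^ 2) s := by
      intro s hs
      rw [Set.uIcc_of_le zero_le_one] at hs
      have hw := (one_add_mul_sub_one_pos ht hs).ne'
      have hlin : HasDerivAt (fun s : ℝ => 1 + s * (t - 1)) (1 * (t - 1)) s :=
        ((hasDerivAt_id s).mul_const (t - 1)).const_add 1
      refine ((((hasDerivAt_const s t).div hlin hw).neg.sub (hlin.log hw)).div_const
        ((t - 1) ^ 2)).congr_deriv ?_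
      field_simp
      ring
    rw [intervalIntegral.integral_eq_sub_of_hasDerivAt hderiv
      (intervalIntegrable_hfun_kernel ht), hfun, if_neg h1, ← sub_div]
    congr 1
    have htt : 1 + 1 * (t - 1) = t := by ring
    rw [htt, div_self ht.ne']
    simp
    ring

theorem hfun_pos {t : ℝ} (ht : 0 < t) : 0 < hfun t := by
  rw [hfun_eq_integral ht]
  refine intervalIntegral.intervalIntegral_pos_of_pos_on (intervalIntegrable_hfun_kernel ht)
    (fun s hs => ?_) zero_lt_one
  exact div_pos (sub_pos.mpr hs.2)
    (pow_pos (one_add_mul_sub_one_pos ht (Set.Ioo_subset_Icc_self hs)) 2)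

theorem hfun_antitoneOn : AntitoneOn hfun (Set.Ioi 0) := by
  intro x hx y hy hxy
  rw [hfun_eq_integral hx, hfun_eq_integral hy]
  refine intervalIntegral.integral_mono_on zero_le_one (intervalIntegrable_hfun_kernel hy)
    (intervalIntegrable_hfun_kernel hx) fun s hs => ?_
  have hpos := one_add_mul_sub_one_pos hx hs
  have hs0 := hs.1
  have hs1 : 0 ≤ 1 - s := sub_nonneg.mpr hs.2
  gcongr

theorem log_eq_sub_hfun_mul_sq (x : ℝ) :
    Real.log x = (x - 1) - hfun x * (x - 1) ^ 2 := by
  by_cases h1 : x = 1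
  · simp [h1]
  · rw [hfun, if_neg h1, div_mul_cancel₀ _ (pow_ne_zero 2 (sub_ne_zero.mpr h1))]
    ring

/-- Elementary log inequality: for each `γ > 0` and every `x ∈ (0, γ]`,
`log x ≤ (x - 1) - h(γ) (x - 1)²`, where `h(γ) > 0`. -/
theorem elem_log_inequality (γ : ℝ) (hγ : 0 < γ) :
    0 < hfun γ ∧
      ∀ x : ℝ, 0 < x → x ≤ γ →
        Real.log x ≤ (x - 1) - hfun γ * (x - 1) ^ 2 := by
  refine ⟨hfun_pos hγ, fun x hx hxγ => ?_⟩
  rw [log_eq_sub_hfun_mul_sq x]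
  have := hfun_antitoneOn hx hγ hxγ
  gcongr
end

section
/- For all f, g ∈ F_B^{[α,β]}, the second moment of the log-likelihood ratio satisfies ∫_B f (log(f/g))² dμ ≤ (β/α²) ∫_B (f − g)² dμ. -/
open MeasureTheory

/-- The density class `F_B^{[α,β]}`: measurable functions `f : B → ℝ` with
`α ≤ f ≤ β` on `B` and `∫_B f dμ = 1`. -/
def DensityClass {d : ℕ} (μ : Measure (Fin d → ℝ)) (B : Set (Fin d → ℝ))
    (α β : ℝ) : Set ((Fin d → ℝ) → ℝ) :=
  {f | Measurable f ∧ (∀ x ∈ B, α ≤ f x ∧ f x ≤ β) ∧ ∫ x in B, f x ∂μ = 1}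

lemma abs_log_div_le {α a b : ℝ} (hα : 0 < α) (ha : α ≤ a) (hb : α ≤ b) :
    |Real.log (a / b)| ≤ |a - b| / α := by
  wlog hab : b ≤ a generalizing a b
  · rw [← inv_div, Real.log_inv, abs_neg, abs_sub_comm]
    exact this hb ha (le_of_not_ge hab)
  have hb0 : 0 < b := hα.trans_le hb
  have h1 : 1 ≤ a / b := (one_le_div hb0).2 hab
  rw [abs_of_nonneg (Real.log_nonneg h1), abs_of_nonneg (sub_nonneg.2 hab)]
  calc Real.log (a / b) ≤ a / b - 1 := Real.log_le_sub_one_of_pos (zero_lt_one.trans_le h1)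
    _ = (a - b) / b := by field_simp
    _ ≤ (a - b) / α := div_le_div_of_nonneg_left (sub_nonneg.2 hab) hα hb

lemma mul_log_div_sq_le {α β a b : ℝ} (hα : 0 < α) (ha : α ≤ a) (haβ : a ≤ β) (hb : α ≤ b) :
    a * Real.log (a / b) ^ 2 ≤ β / α ^ 2 * (a - b) ^ 2 := by
  have h : Real.log (a / b) ^ 2 ≤ (a - b) ^ 2 / α ^ 2 := by
    have := pow_le_pow_left₀ (abs_nonneg _) (abs_log_div_le hα ha hb) 2
    rwa [div_pow, sq_abs, sq_abs] at this
  calc a * Real.log (a / b) ^ 2 ≤ β * ((a - b) ^ 2 / α ^ 2) :=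
        mul_le_mul haβ h (sq_nonneg _) (hα.le.trans (ha.trans haβ))
    _ = β / α ^ 2 * (a - b) ^ 2 := by ring

/-- Second-moment bound for the log-likelihood ratio on `F_B^{[α,β]}`:
`∫_B f (log(f/g))² dμ ≤ (β/α²) ∫_B (f - g)² dμ`. -/
theorem logLikelihood_second_moment {d : ℕ} (μ : Measure (Fin d → ℝ)) [SigmaFinite μ]
    (B : Set (Fin d → ℝ)) (hB : MeasurableSet B) (α β : ℝ)
    (hα : 0 < α) (hα1 : α ≤ 1) (h1β : 1 ≤ β)
    (f g : (Fin d → ℝ) → ℝ)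
    (hf : f ∈ DensityClass μ B α β) (hg : g ∈ DensityClass μ B α β) :
    (∫ x in B, f x * Real.log (f x / g x) ^ 2 ∂μ) ≤
      (β / α ^ 2) * ∫ x in B, (f x - g x) ^ 2 ∂μ := by
  obtain ⟨-, hfb, hf1⟩ := hf
  obtain ⟨-, hgb, hg1⟩ := hg
  have hfi : Integrable f (μ.restrict B) :=
    .of_integral_ne_zero (by rw [hf1]; exact one_ne_zero)
  have hgi : Integrable g (μ.restrict B) :=
    .of_integral_ne_zero (by rw [hg1]; exact one_ne_zero)
  have hd : Integrable (fun x => (f x - g x) ^ 2) (μ.restrict B) := by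
    simp only [sq]
    refine (hfi.sub hgi).bdd_mul (c := β) (hfi.sub hgi).aestronglyMeasurable ?_
    filter_upwards [ae_restrict_mem hB] with x hx
    rw [Real.norm_eq_abs, abs_le]
    constructor <;> linarith [(hfb x hx).1, (hfb x hx).2, (hgb x hx).1, (hgb x hx).2]
  rw [← integral_const_mul]
  refine integral_mono_of_nonneg ?_ (hd.const_mul _) ?_
  · filter_upwards [ae_restrict_mem hB] with x hx
    exact mul_nonneg (hα.le.trans (hfb x hx).1) (sq_nonneg _)
  · filter_upwards [ae_restrict_mem hB] with x hx
    exact mul_log_div_sq_le hα (hfb x hx).1 (hfb x hx).2 (hgb x hx).1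
end

section
/- Let δ > 0 and let C satisfy C > 1 + √(1/(α c(α,β))). Let X₁, …, Xₙ be i.i.d. samples from the probability measure with density f with respect to μ, where f ∈ F_B^{[α,β]}. Then for any g, g' ∈ F_B^{[α,β]} with ‖g − g'‖₂ ≥ Cδ and ‖g' − f‖₂ ≤ δ, the probability that Σ_{i=1}^n log(g(Xᵢ)/g'(Xᵢ)) > 0 is at most exp(−n L(α,β,C) δ²). -/
open MeasureTheory

/-- `c(α, β) = h(β/α)/β`. -/
noncomputable def cConst (α β : ℝ) : ℝ := hfun (β / α) / β

/-- `K(α, β) = β/(α² c(α,β))`. -/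
noncomputable def Kconst (α β : ℝ) : ℝ := β / (α ^ 2 * cConst α β)

/-- `L(α, β, C) = (√(c(α,β))(C-1) - √(1/α))² / (2(2K(α,β) + (2/3) log(β/α)))`. -/
noncomputable def Lconst (α β C : ℝ) : ℝ :=
  (Real.sqrt (cConst α β) * (C - 1) - Real.sqrt (1 / α)) ^ 2 /
    (2 * (2 * Kconst α β + (2 / 3) * Real.log (β / α)))

/-- For nonpositive `x`, the exponential lies below its quadratic Taylor polynomial. -/
lemma exp_le_quadratic_of_nonpos {x : ℝ} (hx : x ≤ 0) :
    Real.exp x ≤ 1 + x + x ^ 2 / 2 := by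
  have hder : ∀ y : ℝ, HasDerivAt (fun y => 1 + y + y ^ 2 / 2 - Real.exp y)
      (1 + y - Real.exp y) y := fun y => by
    have h := (((hasDerivAt_id y).const_add 1).add
      (((hasDerivAt_id y).pow 2).div_const 2)).sub (Real.hasDerivAt_exp y)
    refine h.congr_deriv ?_
    simp
  have hanti : Antitone fun y : ℝ => 1 + y + y ^ 2 / 2 - Real.exp y :=
    antitone_of_hasDerivAt_nonpos hder fun y => by
      have := Real.add_one_le_exp y
      simp only [Pi.zero_apply]
      linarith
  have := hanti hx
  simp only [Real.exp_zero] at this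
  linarith

/-- The Padé-type upper bound for the exponential behind Bernstein's inequality. -/
lemma exp_mul_le_quadratic_of_nonneg {x : ℝ} (hx : 0 ≤ x) :
    Real.exp x * (6 - 2 * x) ≤ 6 + 4 * x + x ^ 2 := by
  have hder : ∀ y : ℝ, HasDerivAt
      (fun y => (6 + 4 * y + y ^ 2) * Real.exp (-y) + 2 * y)
      (2 - (2 + 2 * y + y ^ 2) * Real.exp (-y)) y := fun y => by
    have h := ((((hasDerivAt_id y).const_mul 4).const_add 6).add
      ((hasDerivAt_id y).pow 2)).mul (hasDerivAt_neg y).exp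
    refine (h.add ((hasDerivAt_id y).const_mul 2)).congr_deriv ?_
    simp
    ring
  have hmono : MonotoneOn (fun y : ℝ => (6 + 4 * y + y ^ 2) * Real.exp (-y) + 2 * y)
      (Set.Ici 0) := by
    refine monotoneOn_of_hasDerivWithinAt_nonneg (convex_Ici 0)
      (fun y _ => (hder y).continuousAt.continuousWithinAt)
      (fun y _ => (hder y).hasDerivWithinAt) fun y hy => ?_
    rw [interior_Ici] at hy
    have h1 := Real.quadratic_le_exp_of_nonneg (le_of_lt hy)
    have h2 : Real.exp y * Real.exp (-y) = 1 := by rw [← Real.exp_add]; simp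
    nlinarith [Real.exp_pos (-y)]
  have h := hmono Set.self_mem_Ici (Set.mem_Ici.2 hx) hx
  simp only [neg_zero, Real.exp_zero] at h
  have h2 : Real.exp x * Real.exp (-x) = 1 := by rw [← Real.exp_add]; simp
  have h3 : 6 - 2 * x ≤ (6 + 4 * x + x ^ 2) * Real.exp (-x) := by linarith
  calc Real.exp x * (6 - 2 * x)
      ≤ Real.exp x * ((6 + 4 * x + x ^ 2) * Real.exp (-x)) :=
        mul_le_mul_of_nonneg_left h3 (Real.exp_pos x).le
    _ = 6 + 4 * x + x ^ 2 := by linear_combination (6 + 4 * x + x ^ 2) * h2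

lemma exp_le_one_add_add_sq_div {x m : ℝ} (hxm : x ≤ m) (hm0 : 0 ≤ m) (hm : m < 3) :
    Real.exp x ≤ 1 + x + x ^ 2 / (2 * (1 - m / 3)) := by
  rcases le_total x 0 with hx | hx
  · refine (exp_le_quadratic_of_nonpos hx).trans ?_
    gcongr
    · linarith
    · linarith
  · have h := exp_mul_le_quadratic_of_nonneg hx
    have hx3 : 0 < 1 - x / 3 := by linarith
    have : Real.exp x ≤ 1 + x + x ^ 2 / (2 * (1 - x / 3)) := by
      rw [← sub_le_iff_le_add', le_div_iff₀ (by linarith)]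
      linarith
    refine this.trans ?_
    gcongr
    linarith

/-- Bernstein's bound on the exponential moment of a bounded random variable with negative mean,
at the optimal tilting parameter. -/
lemma integral_exp_le_of_bernstein {Ω : Type*} [MeasurableSpace Ω] {ν : Measure Ω}
    [IsProbabilityMeasure ν] {Y : Ω → ℝ} (hY : Measurable Y) {M t V : ℝ}
    (hM : 0 ≤ M) (ht : 0 < t) (hV : 0 < V) (hYM : ∀ᵐ x ∂ν, |Y x| ≤ M)
    (hmean : ∫ x, Y x ∂ν ≤ -t) (hsq : ∫ x, Y x ^ 2 ∂ν ≤ V) :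
    Integrable (fun x => Real.exp (t / (V + M * t / 3) * Y x)) ν ∧
    ∫ x, Real.exp (t / (V + M * t / 3) * Y x) ∂ν ≤
      Real.exp (-(t ^ 2 / (2 * (V + M * t / 3)))) := by
  set w := V + M * t / 3 with hw
  have hw0 : 0 < w := by positivity
  set l := t / w with hl
  have hl0 : 0 < l := by positivity
  have hlM : l * M < 3 := by
    rw [hl, div_mul_eq_mul_div, div_lt_iff₀ hw0, hw]
    linarith
  have hfac : 1 - l * M / 3 = V / w := by
    rw [hl, eq_div_iff hw0.ne']
    field_simp
    rw [hw]
    ring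
  have hYi : Integrable Y ν := .of_bound hY.aestronglyMeasurable M hYM
  have hY2i : Integrable (fun x => Y x ^ 2) ν := by
    refine .of_bound (hY.pow_const 2).aestronglyMeasurable (M ^ 2) ?_
    filter_upwards [hYM] with x hx
    rw [Real.norm_eq_abs, abs_pow]
    gcongr
  have hei : Integrable (fun x => Real.exp (l * Y x)) ν := by
    refine .of_bound (hY.const_mul l).exp.aestronglyMeasurable (Real.exp (l * M)) ?_
    filter_upwards [hYM] with x hx
    rw [Real.norm_eq_abs, Real.abs_exp]
    gcongr
    exact (le_abs_self _).trans hx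
  refine ⟨hei, ?_⟩
  have hpt : ∀ᵐ x ∂ν, Real.exp (l * Y x) ≤
      1 + l * Y x + l ^ 2 / (2 * (V / w)) * Y x ^ 2 := by
    filter_upwards [hYM] with x hx
    have h := exp_le_one_add_add_sq_div (x := l * Y x) (m := l * M)
      (by gcongr; exact (le_abs_self _).trans hx) (by positivity) hlM
    rw [hfac] at h
    refine h.trans_eq ?_
    ring
  have h1i : Integrable (fun x => 1 + l * Y x) ν := (integrable_const 1).add (hYi.const_mul l)
  calc ∫ x, Real.exp (l * Y x) ∂ν
      ≤ ∫ x, (1 + l * Y x + l ^ 2 / (2 * (V / w)) * Y x ^ 2) ∂ν :=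
        integral_mono_ae hei (h1i.add (hY2i.const_mul _)) hpt
    _ = 1 + l * ∫ x, Y x ∂ν + l ^ 2 / (2 * (V / w)) * ∫ x, Y x ^ 2 ∂ν := by
        rw [integral_add h1i (hY2i.const_mul _),
          integral_add (integrable_const 1) (hYi.const_mul l), integral_const_mul,
          integral_const_mul]
        simp
    _ ≤ 1 + l * (-t) + l ^ 2 / (2 * (V / w)) * V := by gcongr
    _ = -(t ^ 2 / (2 * w)) + 1 := by
        rw [hl]
        field_simp
        ring
    _ ≤ _ := Real.add_one_le_exp _

/-- A Bernstein inequality for the event that a sum of i.i.d. bounded variables with negative mean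
is positive. -/
lemma measure_pi_sum_pos_le_exp {Ω : Type*} [MeasurableSpace Ω] {ν : Measure Ω}
    [IsProbabilityMeasure ν] {Y : Ω → ℝ} (hY : Measurable Y) {M t V : ℝ}
    (hM : 0 ≤ M) (ht : 0 < t) (hV : 0 < V) (hYM : ∀ᵐ x ∂ν, |Y x| ≤ M)
    (hmean : ∫ x, Y x ∂ν ≤ -t) (hsq : ∫ x, Y x ^ 2 ∂ν ≤ V) (n : ℕ) :
    (Measure.pi fun _ : Fin n => ν) {X : Fin n → Ω | 0 < ∑ i, Y (X i)} ≤
      ENNReal.ofReal (Real.exp (-(n * (t ^ 2 / (2 * (V + M * t / 3)))))) := by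
  obtain ⟨hi, hle⟩ := integral_exp_le_of_bernstein hY hM ht hV hYM hmean hsq
  set l := t / (V + M * t / 3) with hl
  have hl0 : 0 ≤ l := by positivity
  have hexp : (fun X : Fin n → Ω => Real.exp (l * ∑ i, Y (X i))) =
      fun X => ∏ i, Real.exp (l * Y (X i)) := by
    funext X
    rw [Finset.mul_sum, Real.exp_sum]
  have hint : Integrable (fun X : Fin n → Ω => Real.exp (l * ∑ i, Y (X i)))
      (Measure.pi fun _ : Fin n => ν) := by
    rw [hexp]
    exact Integrable.fintype_prod fun _ => hi
  have hmgf : ProbabilityTheory.mgf (fun X : Fin n → Ω => ∑ i, Y (X i))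
      (Measure.pi fun _ : Fin n => ν) l = (∫ x, Real.exp (l * Y x) ∂ν) ^ n := by
    rw [ProbabilityTheory.mgf, hexp]
    simpa using integral_fintype_prod_eq_pow (ι := Fin n) (μ := ν)
      (fun x => Real.exp (l * Y x))
  have hch := ProbabilityTheory.measure_ge_le_exp_mul_mgf 0 hl0 hint
  rw [hmgf, mul_zero, Real.exp_zero, one_mul] at hch
  have hsub : {X : Fin n → Ω | 0 < ∑ i, Y (X i)} ⊆ {X | 0 ≤ ∑ i, Y (X i)} :=
    fun X (hX : 0 < ∑ i, Y (X i)) => hX.le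
  refine (measure_mono hsub).trans ?_
  refine (ENNReal.le_ofReal_iff_toReal_le (measure_ne_top _ _) (Real.exp_pos _).le).2 ?_
  refine hch.trans ?_
  calc (∫ x, Real.exp (l * Y x) ∂ν) ^ n
      ≤ Real.exp (-(t ^ 2 / (2 * (V + M * t / 3)))) ^ n := by
        gcongr
    _ = _ := by rw [← Real.exp_nat_mul]; congr 1; ring

lemma sub_one_sub_log_eq_hfun_mul_sq {T : ℝ} (hT : 1 < T) :
    T - 1 - Real.log T = hfun T * (T - 1) ^ 2 := by
  have : T - 1 ≠ 0 := by linarith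
  rw [hfun, if_neg hT.ne', div_mul_cancel₀ _ (by positivity)]

lemma hfun_pos_s12 {T : ℝ} (hT : 0 < T) : 0 < hfun T := by
  rw [hfun]
  split_ifs with h
  · norm_num
  · have : T - 1 ≠ 0 := sub_ne_zero.2 h
    have := Real.log_lt_sub_one_of_pos hT h
    exact div_pos (by linarith) (by positivity)

lemma hfun_le_half {T : ℝ} (hT : 1 ≤ T) : hfun T ≤ 1 / 2 := by
  rw [hfun]
  split_ifs with h
  · rfl
  · have h1 : 0 < T - 1 := by
      have := lt_of_le_of_ne hT (Ne.symm h)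
      linarith
    rw [div_le_iff₀ (by positivity)]
    have h2 := Real.le_log_one_add_of_nonneg h1.le
    rw [add_sub_cancel] at h2
    have h3 : (T - 1) - (T - 1) ^ 2 / 2 ≤ 2 * (T - 1) / (T - 1 + 2) := by
      rw [le_div_iff₀ (by linarith)]
      nlinarith [pow_pos h1 3]
    linarith

/-- On `(0, T]` the function `h` is bounded below by `h(T)`, in multiplied-out form. -/
lemma hfun_mul_sq_le {T r : ℝ} (hT : 1 < T) (hr : 0 < r) (hrT : r ≤ T) :
    hfun T * (r - 1) ^ 2 ≤ r - 1 - Real.log r := by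
  set k := hfun T with hk
  have hk0 : 0 < k := hfun_pos_s12 (by linarith)
  have hk2 : k ≤ 1 / 2 := hfun_le_half hT.le
  set Q : ℝ → ℝ := fun y => y - 1 - Real.log y - k * (y - 1) ^ 2 with hQ
  have hder : ∀ y : ℝ, 0 < y → HasDerivAt Q ((y - 1) * (1 / y - 2 * k)) y := fun y hy => by
    have h := (((hasDerivAt_id y).sub_const 1).sub (Real.hasDerivAt_log hy.ne')).sub
      ((((hasDerivAt_id y).sub_const 1).pow 2).const_mul k)
    refine h.congr_deriv ?_
    simp
    field_simp
  have hQ1 : Q 1 = 0 := by simp [hQ]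
  have hQT : Q T = 0 := by
    simp only [hQ, sub_one_sub_log_eq_hfun_mul_sq hT, ← hk, sub_self]
  suffices 0 ≤ Q r by
    simp only [hQ] at this
    linarith
  have hk1 : 1 ≤ 1 / (2 * k) := by rw [le_div_iff₀ (by positivity)]; linarith
  rcases le_total r 1 with h1 | h1
  · have hanti : AntitoneOn Q (Set.Icc r 1) := by
      refine antitoneOn_of_hasDerivWithinAt_nonpos (convex_Icc r 1)
        (fun y hy => (hder y (hr.trans_le hy.1)).continuousAt.continuousWithinAt)
        (fun y hy => (hder y ?_).hasDerivWithinAt) fun y hy => ?_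
      · rw [interior_Icc] at hy
        exact hr.trans hy.1
      · rw [interior_Icc] at hy
        have hy0 : 0 < y := hr.trans hy.1
        have : 1 ≤ 1 / y := by rw [le_div_iff₀ hy0]; linarith [hy.2]
        exact mul_nonpos_of_nonpos_of_nonneg (by linarith [hy.2]) (by linarith)
    rw [← hQ1]
    exact hanti ⟨le_rfl, h1⟩ ⟨h1, le_rfl⟩ h1
  rcases le_total r (1 / (2 * k)) with h2 | h2
  · have hmono : MonotoneOn Q (Set.Icc 1 r) := by
      refine monotoneOn_of_hasDerivWithinAt_nonneg (convex_Icc 1 r)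
        (fun y hy => (hder y (by linarith [hy.1])).continuousAt.continuousWithinAt)
        (fun y hy => (hder y ?_).hasDerivWithinAt) fun y hy => ?_
      · rw [interior_Icc] at hy
        linarith [hy.1]
      · rw [interior_Icc] at hy
        have hy0 : 0 < y := by linarith [hy.1]
        have h3 := hy.2.le.trans h2
        rw [le_div_iff₀ (by positivity)] at h3
        have : 2 * k ≤ 1 / y := by rw [le_div_iff₀ hy0]; linarith
        exact mul_nonneg (by linarith [hy.1]) (by linarith)
    rw [← hQ1]
    exact hmono ⟨le_rfl, h1⟩ ⟨h1, le_rfl⟩ h1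
  · have hanti : AntitoneOn Q (Set.Icc r T) := by
      refine antitoneOn_of_hasDerivWithinAt_nonpos (convex_Icc r T)
        (fun y hy => (hder y (hr.trans_le hy.1)).continuousAt.continuousWithinAt)
        (fun y hy => (hder y ?_).hasDerivWithinAt) fun y hy => ?_
      · rw [interior_Icc] at hy
        exact hr.trans hy.1
      · rw [interior_Icc] at hy
        have hy0 : 0 < y := hr.trans hy.1
        have h3 := h2.trans hy.1.le
        rw [div_le_iff₀ (by positivity)] at h3
        have : 1 / y ≤ 2 * k := by rw [div_le_iff₀ hy0]; linarith
        exact mul_nonpos_of_nonneg_of_nonpos (by linarith [hy.1]) (by linarith)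
    rw [← hQT]
    exact hanti ⟨le_rfl, hrT⟩ ⟨hrT, le_rfl⟩ hrT

lemma cConst_pos {α β : ℝ} (hα : 0 < α) (hαβ : α < β) : 0 < cConst α β :=
  div_pos (hfun_pos_s12 (div_pos (hα.trans hαβ) hα)) (hα.trans hαβ)

lemma cConst_le_one_div {α β : ℝ} (hα : 0 < α) (hαβ : α < β) : cConst α β ≤ 1 / α := by
  have h1 : hfun (β / α) ≤ 1 := by
    have := hfun_le_half (T := β / α) (by rw [le_div_iff₀ hα]; linarith)
    linarith
  rw [cConst]
  gcongr

/-- The pointwise estimate whose integral compares the Kullback–Leibler divergences of `q` and `r`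
from `p` with squared `L²` distances. -/
lemma mul_log_div_le {α β p q r : ℝ} (hα : 0 < α) (hαβ : α < β)
    (hp : α ≤ p ∧ p ≤ β) (hq : α ≤ q ∧ q ≤ β) (hr : α ≤ r) :
    p * Real.log (q / r) ≤
      (q - r) - cConst α β * (q - p) ^ 2 + 1 / α * (r - p) ^ 2 := by
  have hp0 : 0 < p := hα.trans_le hp.1
  have hq0 : 0 < q := hα.trans_le hq.1
  have hr0 : 0 < r := hα.trans_le hr
  have hβ0 : 0 < β := hα.trans hαβ
  have hk := hfun_pos_s12 (div_pos hβ0 hα)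
  have hsplit : Real.log (q / r) = Real.log (q / p) + Real.log (p / r) := by
    rw [← Real.log_mul (by positivity) (by positivity)]
    congr 1
    field_simp
  have h1 : p * Real.log (q / p) ≤ (q - p) - cConst α β * (q - p) ^ 2 := by
    have h := hfun_mul_sq_le (T := β / α) (r := q / p) (by rw [lt_div_iff₀ hα]; linarith)
      (by positivity) (by gcongr; exacts [hq.2, hp.1])
    have h2 : p * Real.log (q / p) ≤ p * (q / p - 1 - hfun (β / α) * (q / p - 1) ^ 2) :=
      mul_le_mul_of_nonneg_left (by linarith) hp0.le
    have h3 : p * (q / p - 1 - hfun (β / α) * (q / p - 1) ^ 2) =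
        (q - p) - hfun (β / α) / p * (q - p) ^ 2 := by
      field_simp
    have h4 : cConst α β * (q - p) ^ 2 ≤ hfun (β / α) / p * (q - p) ^ 2 := by
      rw [cConst]
      gcongr
      exact hp.2
    linarith
  have h2 : p * Real.log (p / r) ≤ (p - r) + 1 / α * (r - p) ^ 2 := by
    have h := Real.log_le_sub_one_of_pos (div_pos hp0 hr0)
    have h2 : p * Real.log (p / r) ≤ p * (p / r - 1) := mul_le_mul_of_nonneg_left h hp0.le
    have h3 : p * (p / r - 1) = (p - r) + 1 / r * (r - p) ^ 2 := by
      field_simp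
      ring
    have h4 : 1 / r * (r - p) ^ 2 ≤ 1 / α * (r - p) ^ 2 := by gcongr
    linarith
  rw [hsplit, mul_add]
  linarith

lemma abs_log_div_le_abs_sub_div {α q r : ℝ} (hα : 0 < α) (hq : α ≤ q) (hr : α ≤ r) :
    |Real.log (q / r)| ≤ |q - r| / α := by
  have key : ∀ {a b : ℝ}, α ≤ a → α ≤ b → Real.log (a / b) ≤ |a - b| / α := by
    intro a b ha hb
    have ha0 : 0 < a := hα.trans_le ha
    have hb0 : 0 < b := hα.trans_le hb
    calc Real.log (a / b) ≤ a / b - 1 := Real.log_le_sub_one_of_pos (by positivity)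
      _ = (a - b) / b := by field_simp
      _ ≤ |a - b| / b := by gcongr; exact le_abs_self _
      _ ≤ |a - b| / α := by gcongr
  refine abs_le'.2 ⟨key hq hr, ?_⟩
  rw [← Real.log_inv, inv_div, abs_sub_comm]
  exact key hr hq

lemma abs_log_div_le_log_div {α β q r : ℝ} (hα : 0 < α)
    (hq : α ≤ q ∧ q ≤ β) (hr : α ≤ r ∧ r ≤ β) :
    |Real.log (q / r)| ≤ Real.log (β / α) := by
  have hq0 : 0 < q := hα.trans_le hq.1
  have hr0 : 0 < r := hα.trans_le hr.1
  refine abs_le'.2 ⟨Real.log_le_log (by positivity) ?_, ?_⟩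
  · gcongr
    exacts [hq0.le.trans hq.2, hq.2, hr.1]
  · rw [← Real.log_inv, inv_div]
    refine Real.log_le_log (by positivity) ?_
    gcongr
    exacts [hr0.le.trans hr.2, hr.2, hq.1]

lemma mul_log_div_sq_le_s12 {α β p q r : ℝ} (hα : 0 < α)
    (hp : α ≤ p ∧ p ≤ β) (hq : α ≤ q) (hr : α ≤ r) :
    p * Real.log (q / r) ^ 2 ≤
      β / α ^ 2 * (2 * (q - p) ^ 2 + 2 * (r - p) ^ 2) := by
  have hβ0 : 0 < β := hα.trans_le (hp.1.trans hp.2)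
  have h1 : Real.log (q / r) ^ 2 ≤ (q - r) ^ 2 / α ^ 2 := by
    rw [← sq_abs, ← sq_abs (q - r), ← div_pow]
    gcongr
    exact abs_log_div_le_abs_sub_div hα hq hr
  calc p * Real.log (q / r) ^ 2 ≤ β * ((q - r) ^ 2 / α ^ 2) := by
        gcongr
        exact hp.2
    _ = β / α ^ 2 * (q - r) ^ 2 := by ring
    _ ≤ _ := by
        gcongr
        nlinarith [sq_nonneg ((q - p) + (r - p))]

/-- The `L²` triangle inequality in the form needed for separated densities. -/
lemma le_integral_sq_of_integral_sq_sub {Ω : Type*} [MeasurableSpace Ω] {ρ : Measure Ω}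
    {u v : Ω → ℝ} (hu : Integrable (fun x => u x ^ 2) ρ) (hv : Integrable (fun x => v x ^ 2) ρ)
    (huv : Integrable (fun x => (u x - v x) ^ 2) ρ) {A δ : ℝ} (hA : 0 < A) (hδ : 0 < δ)
    (hv' : ∫ x, v x ^ 2 ∂ρ ≤ δ ^ 2) (huv' : (A + δ) ^ 2 ≤ ∫ x, (u x - v x) ^ 2 ∂ρ) :
    A ^ 2 ≤ ∫ x, u x ^ 2 ∂ρ := by
  have h : ∫ x, (u x - v x) ^ 2 ∂ρ ≤
      (1 + δ / A) * ∫ x, u x ^ 2 ∂ρ + (1 + A / δ) * ∫ x, v x ^ 2 ∂ρ := by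
    rw [← integral_const_mul, ← integral_const_mul,
      ← integral_add (hu.const_mul _) (hv.const_mul _)]
    refine integral_mono huv ((hu.const_mul _).add (hv.const_mul _)) fun x => ?_
    have : (1 + δ / A) * u x ^ 2 + (1 + A / δ) * v x ^ 2 - (u x - v x) ^ 2 =
        (δ * u x + A * v x) ^ 2 / (A * δ) := by
      field_simp
      ring
    have h0 : 0 ≤ (δ * u x + A * v x) ^ 2 / (A * δ) := by positivity
    beta_reduce
    linarith
  have h2 : (1 + A / δ) * ∫ x, v x ^ 2 ∂ρ ≤ (1 + A / δ) * δ ^ 2 := by gcongr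
  have h3 : (1 + A / δ) * δ ^ 2 = δ ^ 2 + A * δ := by field_simp
  have h4 : (1 + δ / A) * A ^ 2 = A ^ 2 + A * δ := by field_simp
  have h5 : (1 + δ / A) * A ^ 2 ≤ (1 + δ / A) * ∫ x, u x ^ 2 ∂ρ := by nlinarith
  exact le_of_mul_le_mul_left h5 (by positivity)

/-- The Bernstein exponent with `t = uv` and `V = 2Kv²` dominates the stated rate. -/
lemma rate_le_bernstein_exponent {K l s u v : ℝ} (hK : 0 < K) (hl : 0 ≤ l) (hs : 0 ≤ s)
    (hsu : s ≤ u) (hu : 0 < u) (huv : u ≤ v) :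
    s ^ 2 / (2 * (2 * K + l)) ≤
      (u * v) ^ 2 / (2 * (2 * K * v ^ 2 + l * (u * v))) := by
  have hv : 0 < v := hu.trans_le huv
  calc s ^ 2 / (2 * (2 * K + l)) ≤ u ^ 2 / (2 * (2 * K + l)) := by gcongr
    _ = (u * v) ^ 2 / (2 * (2 * K * v ^ 2 + l * (v * v))) := by
        field_simp
    _ ≤ _ := by gcongr

set_option maxHeartbeats 1000000 in
/-- Log-likelihood deviation bound: for `f, g, g' ∈ F_B^{[α,β]}` with
`‖g - g'‖₂ ≥ Cδ` and `‖g' - f‖₂ ≤ δ`, the probability under `n` i.i.d. samples from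
the density `f` that `Σᵢ log(g(Xᵢ)/g'(Xᵢ)) > 0` is at most `exp(-n L(α,β,C) δ²)`. -/
theorem logLikelihood_bernstein {d : ℕ} (μ : Measure (Fin d → ℝ)) [SigmaFinite μ]
    (B : Set (Fin d → ℝ)) (hB : MeasurableSet B) (α β : ℝ)
    (hα : 0 < α) (hα1 : α ≤ 1) (h1β : 1 ≤ β)
    (δ : ℝ) (hδ : 0 < δ) (C : ℝ)
    (hC : 1 + Real.sqrt (1 / (α * cConst α β)) < C)
    (f g g' : (Fin d → ℝ) → ℝ)
    (hf : f ∈ DensityClass μ B α β) (hg : g ∈ DensityClass μ B α β)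
    (hg' : g' ∈ DensityClass μ B α β)
    (hgg' : C * δ ≤ Real.sqrt (∫ x in B, (g x - g' x) ^ 2 ∂μ))
    (hg'f : Real.sqrt (∫ x in B, (g' x - f x) ^ 2 ∂μ) ≤ δ)
    (n : ℕ) :
    (Measure.pi fun _ : Fin n =>
        (μ.restrict B).withDensity fun y => ENNReal.ofReal (f y))
      {X : Fin n → Fin d → ℝ | 0 < ∑ i, Real.log (g (X i) / g' (X i))} ≤
      ENNReal.ofReal (Real.exp (-(n : ℝ) * Lconst α β C * δ ^ 2)) := by
  obtain ⟨hfm, hfb, hf1⟩ := hf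
  obtain ⟨hgm, hgb, hg1⟩ := hg
  obtain ⟨hgm', hgb', hg1'⟩ := hg'
  have hC1 : 1 < C := by linarith [Real.sqrt_nonneg (1 / (α * cConst α β))]
  -- The separation hypothesis rules out `α = β`.
  have hαβ : α < β := by
    refine lt_of_le_of_ne (hα1.trans h1β) fun h => ?_
    have h0 : ∫ x in B, (g x - g' x) ^ 2 ∂μ = 0 := by
      rw [← integral_zero (Fin d → ℝ) ℝ (μ := μ.restrict B)]
      refine setIntegral_congr_fun hB fun x hx => ?_
      have e : g x = g' x := by linarith [(hgb x hx).1, (hgb x hx).2, (hgb' x hx).1, (hgb' x hx).2]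
      simp [e]
    rw [h0, Real.sqrt_zero] at hgg'
    have : 0 < C * δ := by positivity
    linarith
  set c := cConst α β with hc
  have hc0 : 0 < c := cConst_pos hα hαβ
  have hcα : c ≤ 1 / α := cConst_le_one_div hα hαβ
  have hβ0 : 0 < β := hα.trans hαβ
  set ρ := μ.restrict B with hρ
  have hB' : ∀ᵐ x ∂ρ, x ∈ B := ae_restrict_mem hB
  have hfi : Integrable f ρ := integrable_of_integral_eq_one hf1
  have hgi : Integrable g ρ := integrable_of_integral_eq_one hg1
  have hgi' : Integrable g' ρ := integrable_of_integral_eq_one hg1'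
  have hfin : IsFiniteMeasure ρ := by
    have hαi : Integrable (fun _ => α) ρ := by
      refine hfi.mono' aestronglyMeasurable_const ?_
      filter_upwards [hB'] with x hx
      rw [Real.norm_eq_abs, abs_of_pos hα]
      exact (hfb x hx).1
    exact (integrable_const_iff.1 hαi).resolve_left hα.ne'
  have hsqi : ∀ {p q : (Fin d → ℝ) → ℝ}, Measurable p → Measurable q →
      (∀ x ∈ B, α ≤ p x ∧ p x ≤ β) → (∀ x ∈ B, α ≤ q x ∧ q x ≤ β) →
      Integrable (fun x => (p x - q x) ^ 2) ρ := by
    intro p q hp hq hpb hqb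
    refine .of_bound ((hp.sub hq).pow_const 2).aestronglyMeasurable (β ^ 2) ?_
    filter_upwards [hB'] with x hx
    rw [Real.norm_eq_abs, abs_pow]
    gcongr
    exact abs_le.2 ⟨by linarith [(hpb x hx).1, (hqb x hx).2],
      by linarith [(hpb x hx).2, (hqb x hx).1]⟩
  have hgfi := hsqi hgm hfm hgb hfb
  have hgfi' := hsqi hgm' hfm hgb' hfb
  set a2 := ∫ x, (g x - f x) ^ 2 ∂ρ with ha2
  set b2 := ∫ x, (g' x - f x) ^ 2 ∂ρ with hb2
  have hb2δ : b2 ≤ δ ^ 2 := (Real.sqrt_le_left hδ.le).1 hg'f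
  have ha2δ : ((C - 1) * δ) ^ 2 ≤ a2 := by
    refine le_integral_sq_of_integral_sq_sub hgfi hgfi' ?_ (by nlinarith) hδ hb2δ ?_
    · simpa using hsqi hgm hgm' hgb hgb'
    · have h := (Real.le_sqrt' (by positivity)).1 hgg'
      simp only [sub_sub_sub_cancel_right]
      calc ((C - 1) * δ + δ) ^ 2 = (C * δ) ^ 2 := by ring
        _ ≤ _ := h
  have ha2nn : 0 ≤ a2 := integral_nonneg fun x => sq_nonneg _
  set ν := ρ.withDensity fun y => ENNReal.ofReal (f y) with hν
  have hf0 : 0 ≤ᵐ[ρ] f := by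
    filter_upwards [hB'] with x hx using hα.le.trans (hfb x hx).1
  have hνp : IsProbabilityMeasure ν := by
    refine ⟨?_⟩
    rw [hν, withDensity_apply _ MeasurableSet.univ, Measure.restrict_univ,
      ← ofReal_integral_eq_lintegral_ofReal hfi hf0, hf1, ENNReal.ofReal_one]
  have hνB : ∀ᵐ x ∂ν, x ∈ B := (withDensity_absolutelyContinuous _ _) hB'
  have hνint : ∀ Z : (Fin d → ℝ) → ℝ, ∫ x, Z x ∂ν = ∫ x, f x * Z x ∂ρ := by
    intro Z
    rw [hν, integral_withDensity_eq_integral_toReal_smul hfm.ennreal_ofReal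
      (ae_of_all _ fun _ => ENNReal.ofReal_lt_top)]
    refine integral_congr_ae ?_
    filter_upwards [hf0] with x hx
    rw [ENNReal.toReal_ofReal hx, smul_eq_mul]
  set Y : (Fin d → ℝ) → ℝ := fun x => Real.log (g x / g' x) with hYdef
  have hYm : Measurable Y := (hgm.div hgm').log
  have hY : ∀ x ∈ B, |Y x| ≤ Real.log (β / α) := fun x hx =>
    abs_log_div_le_log_div hα (hgb x hx) (hgb' x hx)
  have hlog : 0 ≤ Real.log (β / α) := Real.log_nonneg (by rw [le_div_iff₀ hα]; linarith)
  have hbdd : ∀ {Z : (Fin d → ℝ) → ℝ} {M : ℝ}, Measurable Z → (∀ x ∈ B, |Z x| ≤ M) →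
      Integrable (fun x => f x * Z x) ρ := by
    intro Z M hZ hZM
    refine hfi.mul_bdd (c := M) hZ.aestronglyMeasurable ?_
    filter_upwards [hB'] with x hx using hZM x hx
  have hmean : ∫ x, Y x ∂ν ≤ -c * a2 + 1 / α * b2 := by
    rw [hνint]
    calc ∫ x, f x * Y x ∂ρ
        ≤ ∫ x, ((g x - g' x) - c * (g x - f x) ^ 2 + 1 / α * (g' x - f x) ^ 2) ∂ρ := by
          refine integral_mono_ae (hbdd hYm hY)
            (((hgi.sub hgi').sub (hgfi.const_mul c)).add (hgfi'.const_mul _)) ?_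
          filter_upwards [hB'] with x hx using
            mul_log_div_le hα hαβ (hfb x hx) (hgb x hx) (hgb' x hx).1
      _ = _ := by
          have h1 : Integrable (fun x => g x - g' x) ρ := hgi.sub hgi'
          have h2 : Integrable (fun x => (g x - g' x) - c * (g x - f x) ^ 2) ρ :=
            h1.sub (hgfi.const_mul c)
          rw [integral_add h2 (hgfi'.const_mul _), integral_sub h1 (hgfi.const_mul c),
            integral_sub hgi hgi', integral_const_mul, integral_const_mul, hg1, hg1']
          ring
  have hsq : ∫ x, Y x ^ 2 ∂ν ≤ β / α ^ 2 * (2 * a2 + 2 * b2) := by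
    rw [hνint]
    calc ∫ x, f x * Y x ^ 2 ∂ρ
        ≤ ∫ x, β / α ^ 2 * (2 * (g x - f x) ^ 2 + 2 * (g' x - f x) ^ 2) ∂ρ := by
          refine integral_mono_ae (hbdd (M := Real.log (β / α) ^ 2) (hYm.pow_const 2)
            fun x hx => ?_) (((hgfi.const_mul 2).add (hgfi'.const_mul 2)).const_mul _) ?_
          · rw [abs_pow]
            gcongr
            exact hY x hx
          · filter_upwards [hB'] with x hx using
              mul_log_div_sq_le_s12 hα (hfb x hx) (hgb x hx).1 (hgb' x hx).1
      _ = _ := by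
          rw [integral_const_mul, integral_add (hgfi.const_mul 2) (hgfi'.const_mul 2),
            integral_const_mul, integral_const_mul]
  set K := Kconst α β with hK
  have hKc : K * c = β / α ^ 2 := by
    rw [hK, Kconst, ← hc]
    field_simp
  have hK0 : 0 < K := by
    rw [hK, Kconst, ← hc]
    positivity
  set r := Real.sqrt (1 / α) * δ with hr
  set p := Real.sqrt (c * a2) with hp
  have hp2 : p ^ 2 = c * a2 := Real.sq_sqrt (by positivity)
  have hr2 : r ^ 2 = 1 / α * δ ^ 2 := by rw [hr, mul_pow, Real.sq_sqrt (by positivity)]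
  have hr0 : 0 ≤ r := by positivity
  have hsep : 0 < Real.sqrt c * (C - 1) - Real.sqrt (1 / α) := by
    have h1 : Real.sqrt c * Real.sqrt (1 / (α * c)) = Real.sqrt (1 / α) := by
      rw [← Real.sqrt_mul hc0.le]
      congr 1
      field_simp
    have h2 : Real.sqrt c * Real.sqrt (1 / (α * c)) < Real.sqrt c * (C - 1) := by
      have := Real.sqrt_pos.2 hc0
      gcongr
      linarith
    linarith
  have hpr : (Real.sqrt c * (C - 1) - Real.sqrt (1 / α)) * δ ≤ p - r := by
    have : Real.sqrt c * ((C - 1) * δ) ≤ p := by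
      rw [hp, Real.sqrt_mul hc0.le]
      gcongr
      exact Real.le_sqrt_of_sq_le ha2δ
    rw [hr]
    linarith
  have hs0 : 0 < (Real.sqrt c * (C - 1) - Real.sqrt (1 / α)) * δ := by positivity
  have hu0 : 0 < p - r := hs0.trans_le hpr
  have hv0 : 0 < p + r := by linarith
  have hbα : 1 / α * b2 ≤ 1 / α * δ ^ 2 := by gcongr
  have hmean' : ∫ x, Y x ∂ν ≤ -((p - r) * (p + r)) := by
    have : (p - r) * (p + r) = p ^ 2 - r ^ 2 := by ring
    rw [this, hp2, hr2]
    linarith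
  have hsq' : ∫ x, Y x ^ 2 ∂ν ≤ 2 * K * (p + r) ^ 2 := by
    have h1 : c * b2 ≤ r ^ 2 := by
      rw [hr2]
      have : 0 ≤ δ ^ 2 := sq_nonneg _
      nlinarith
    have h2 : c * (a2 + b2) ≤ (p + r) ^ 2 := by nlinarith
    calc ∫ x, Y x ^ 2 ∂ν ≤ β / α ^ 2 * (2 * a2 + 2 * b2) := hsq
      _ = 2 * K * (c * (a2 + b2)) := by rw [← hKc]; ring
      _ ≤ _ := by gcongr
  refine (measure_pi_sum_pos_le_exp hYm (M := 2 * Real.log (β / α)) (by positivity)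
    (mul_pos hu0 hv0) (by positivity) ?_ hmean' hsq' n).trans ?_
  · filter_upwards [hνB] with x hx
    linarith [hY x hx]
  · refine ENNReal.ofReal_le_ofReal (Real.exp_le_exp.2 ?_)
    have hrate := rate_le_bernstein_exponent (l := 2 / 3 * Real.log (β / α)) hK0
      (by positivity) hs0.le hpr hu0 (by linarith : p - r ≤ p + r)
    have hL : Lconst α β C * δ ^ 2 =
        ((Real.sqrt c * (C - 1) - Real.sqrt (1 / α)) * δ) ^ 2 /
          (2 * (2 * K + 2 / 3 * Real.log (β / α))) := by
      rw [Lconst, ← hc, ← hK]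
      ring
    rw [show -(n : ℝ) * Lconst α β C * δ ^ 2 = -(n * (Lconst α β C * δ ^ 2)) by ring, hL]
    refine neg_le_neg (mul_le_mul_of_nonneg_left (hrate.trans_eq ?_) n.cast_nonneg)
    ring
end
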